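/- Let μ be a dominant element of the root lattice Q which is a sum of two orthogonal short roots and is not itself a root. Then for every element γ of the Weyl group orbit Wμ one has D_γ = D_γ(s) = n(γ), where n(γ) is the total number of negative roots occurring among the members of all unordered pairs {α,β} of short roots with α + β = γ (each such pair contributing the number of its two members that are negative roots). -/

import Mathlib

open scoped RealInnerProductSpace

attribute [local instance] Classical.propDecidable

noncomputable section

/-- The reflection in the hyperplane orthogonal to `α`. -/
def sref {V : Type*} [NormedAddCommGroup V] [InnerProductSpace ℝ V] (α x : V) : V :=
  x - (2 * ⟪x, α⟫ / ⟪α, α⟫) • α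

/-- The coroot `α^∨ = 2α/(α,α)`. -/
def coroot {V : Type*} [NormedAddCommGroup V] [InnerProductSpace ℝ V] (α : V) : V :=
  (2 / ⟪α, α⟫) • α

/-- The data of a finite reduced irreducible crystallographic root system `R` in a real
inner product space, together with a fixed choice of positive roots and simple roots. -/
structure RSD (V : Type*) [NormedAddCommGroup V] [InnerProductSpace ℝ V] where
  R : Finset V
  Rpos : Finset V
  n : ℕ
  npos : 0 < n
  simple : Fin n → V
  simple_mem : ∀ i, simple i ∈ Rpos
  pos_sub : Rpos ⊆ R
  root_ne_zero : ∀ α ∈ R, α ≠ 0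
  pos_or_neg : ∀ α ∈ R, α ∈ Rpos ∨ -α ∈ Rpos
  not_both : ∀ α ∈ Rpos, -α ∉ Rpos
  pos_combo : ∀ α ∈ Rpos, ∃ c : Fin n → ℕ, α = ∑ i, (c i : ℝ) • simple i
  simple_indep : LinearIndependent ℝ simple
  reduced : ∀ α ∈ R, ∀ c : ℝ, c • α ∈ R → c = 1 ∨ c = -1
  crystal : ∀ α ∈ R, ∀ β ∈ R, ∃ k : ℤ, ⟪β, coroot α⟫ = (k : ℝ)
  refl_mem : ∀ α ∈ R, ∀ β ∈ R, sref α β ∈ R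
  spanning : Submodule.span ℝ (R : Set V) = ⊤
  irred : ∀ s : Set V, (∀ α ∈ R, ∀ β ∈ R, α ∈ s → β ∉ s → ⟪α, β⟫ = 0) →
    (∀ α ∈ R, α ∈ s) ∨ (∀ α ∈ R, α ∉ s)

namespace RSD

variable {V : Type*} [NormedAddCommGroup V] [InnerProductSpace ℝ V]

/-- The map of `V` determined by a word in the simple reflections. -/
def wordMap (S : RSD V) (l : List (Fin S.n)) : V → V :=
  l.foldr (fun i f => sref (S.simple i) ∘ f) id

/-- `w : V → V` is an element of the Weyl group `W`, i.e. a product of simple reflections. -/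
def IsWeyl (S : RSD V) (w : V → V) : Prop := ∃ l : List (Fin S.n), w = S.wordMap l

/-- The length `ℓ(w)` of a Weyl group element: the smallest length of a word in the simple
reflections representing `w`. -/
def len (S : RSD V) (w : V → V) : ℕ :=
  sInf {k | ∃ l : List (Fin S.n), l.length = k ∧ w = S.wordMap l}

/-- `x` and `y` lie in the same Weyl group orbit. -/
def sameOrbit (S : RSD V) (x y : V) : Prop := ∃ w, S.IsWeyl w ∧ w x = y

/-- `x` is dominant: `(x, α_i) ≥ 0` for all simple roots. -/
def Dominant (S : RSD V) (x : V) : Prop := ∀ i, 0 ≤ ⟪x, S.simple i⟫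

/-- `w` is a Weyl group element of minimal length among those sending `x` to `y`. -/
def IsMinWord (S : RSD V) (x y : V) (w : V → V) : Prop :=
  S.IsWeyl w ∧ w x = y ∧ ∀ w' : V → V, S.IsWeyl w' → w' x = y → S.len w ≤ S.len w'

/-- Membership in the root lattice `Q`, the ℤ-span of the simple roots. -/
def inQ (S : RSD V) (x : V) : Prop :=
  ∃ c : Fin S.n → ℤ, x = ∑ i, (c i : ℝ) • S.simple i

/-- The height `ht(λ) = Σ a_i` of an element `λ = Σ a_i α_i` of the root lattice
(the coefficients are unique since the simple roots are linearly independent). -/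
def htZ (S : RSD V) (x : V) : ℤ :=
  if h : ∃ c : Fin S.n → ℤ, x = ∑ i, (c i : ℝ) • S.simple i then ∑ i, h.choose i else 0

/-- The inversion set `Π(w) = {α ∈ R⁺ : w(α) ∈ R⁻}`. -/
def PiSet (S : RSD V) (w : V → V) : Finset V :=
  S.Rpos.filter (fun α => -(w α) ∈ S.Rpos)

/-- `α` is a short root (if all roots have the same length, all roots are short). -/
def IsShort (S : RSD V) (α : V) : Prop :=
  α ∈ S.R ∧ ∀ β ∈ S.R, ⟪α, α⟫ ≤ ⟪β, β⟫

/-- `α` is a long root. -/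
def IsLong (S : RSD V) (α : V) : Prop :=
  α ∈ S.R ∧ ∀ β ∈ S.R, ⟪β, β⟫ ≤ ⟪α, α⟫

/-- The short roots in the inversion set `Π(w)`. -/
def PiS (S : RSD V) (w : V → V) : Finset V :=
  (S.PiSet w).filter (fun α => S.IsShort α)

/-- The long roots in the inversion set `Π(w)`. -/
def PiL (S : RSD V) (w : V → V) : Finset V :=
  (S.PiSet w).filter (fun α => S.IsLong α)

end RSD


/-- The total number `n(γ)` of negative roots occurring among the members of all unordered
pairs `{α, β}` of short roots with `α + β = γ`, each pair contributing the number of its two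
members that are negative roots.  Since `α ≠ β` in any such pair, this equals the number of
ordered pairs `(α, β)` of short roots with `α + β = γ` whose first member is a negative
root. -/
def negCount {V : Type*} [NormedAddCommGroup V] [InnerProductSpace ℝ V]
    (S : RSD V) (γ : V) : ℕ :=
  ((S.R ×ˢ S.R).filter
    (fun p => S.IsShort p.1 ∧ S.IsShort p.2 ∧ p.1 + p.2 = γ ∧ -p.1 ∈ S.Rpos)).card

section Reflection

variable {V : Type*} [NormedAddCommGroup V] [InnerProductSpace ℝ V]

theorem inner_coroot (x α : V) : ⟪x, coroot α⟫ = 2 * ⟪x, α⟫ / ⟪α, α⟫ := by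
  rw [coroot, inner_smul_right]
  ring

theorem sref_eq_sub_inner_coroot (α x : V) : sref α x = x - ⟪x, coroot α⟫ • α := by
  rw [sref, inner_coroot]

theorem sref_add (α x y : V) : sref α (x + y) = sref α x + sref α y := by
  simp only [sref_eq_sub_inner_coroot, inner_add_left, add_smul]
  abel

theorem sref_smul (α : V) (c : ℝ) (x : V) : sref α (c • x) = c • sref α x := by
  simp only [sref_eq_sub_inner_coroot, real_inner_smul_left, smul_sub, mul_smul]

theorem sref_neg_left (α x : V) : sref (-α) x = sref α x := by
  simp [sref, neg_div]

theorem sref_self {α : V} (hα : α ≠ 0) : sref α α = -α := by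
  have h : ⟪α, α⟫ ≠ 0 := inner_self_ne_zero.mpr hα
  rw [sref, mul_div_assoc, div_self h, mul_one, two_smul]
  abel

theorem inner_sref_sref (α x y : V) : ⟪sref α x, sref α y⟫ = ⟪x, y⟫ := by
  by_cases hα : α = 0
  · simp [sref, hα]
  have h : ⟪α, α⟫ ≠ 0 := inner_self_ne_zero.mpr hα
  simp only [sref, inner_sub_left, inner_sub_right, real_inner_smul_left, real_inner_smul_right,
    real_inner_comm α y]
  rw [real_inner_comm y α]
  field_simp
  ring

theorem sref_sref (α x : V) : sref α (sref α x) = x := by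
  by_cases hα : α = 0
  · simp [sref, hα]
  rw [sref_eq_sub_inner_coroot α x, sub_eq_add_neg, sref_add, ← neg_smul, sref_smul, sref_self hα,
    sref_eq_sub_inner_coroot]
  simp

theorem sref_of_inner_eq_zero {α x : V} (h : ⟪x, α⟫ = 0) : sref α x = x := by
  simp [sref, h]

end Reflection

namespace RSD

variable {V : Type*} [NormedAddCommGroup V] [InnerProductSpace ℝ V] (S : RSD V)

section WordMap

theorem wordMap_cons (i : Fin S.n) (l : List (Fin S.n)) (x : V) :
    S.wordMap (i :: l) x = sref (S.simple i) (S.wordMap l x) := rfl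

theorem wordMap_append (l l' : List (Fin S.n)) (x : V) :
    S.wordMap (l ++ l') x = S.wordMap l (S.wordMap l' x) := by
  induction l with
  | nil => rfl
  | cons i l ih => rw [List.cons_append, wordMap_cons, wordMap_cons, ih]

theorem wordMap_wordMap_reverse (l : List (Fin S.n)) (x : V) :
    S.wordMap l (S.wordMap l.reverse x) = x := by
  induction l generalizing x with
  | nil => rfl
  | cons i l ih =>
    rw [List.reverse_cons, wordMap_append, wordMap_cons, ih]
    exact sref_sref _ _

theorem wordMap_reverse_wordMap (l : List (Fin S.n)) (x : V) :
    S.wordMap l.reverse (S.wordMap l x) = x := by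
  simpa using S.wordMap_wordMap_reverse l.reverse x

theorem wordMap_add (l : List (Fin S.n)) (x y : V) :
    S.wordMap l (x + y) = S.wordMap l x + S.wordMap l y := by
  induction l with
  | nil => rfl
  | cons i l ih => simp only [wordMap_cons, ih, sref_add]

theorem wordMap_smul (l : List (Fin S.n)) (c : ℝ) (x : V) :
    S.wordMap l (c • x) = c • S.wordMap l x := by
  induction l with
  | nil => rfl
  | cons i l ih => simp only [wordMap_cons, ih, sref_smul]

theorem wordMap_neg (l : List (Fin S.n)) (x : V) : S.wordMap l (-x) = -S.wordMap l x := by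
  simpa using S.wordMap_smul l (-1) x

theorem wordMap_sub (l : List (Fin S.n)) (x y : V) :
    S.wordMap l (x - y) = S.wordMap l x - S.wordMap l y := by
  rw [sub_eq_add_neg, wordMap_add, wordMap_neg, ← sub_eq_add_neg]

theorem inner_wordMap_wordMap (l : List (Fin S.n)) (x y : V) :
    ⟪S.wordMap l x, S.wordMap l y⟫ = ⟪x, y⟫ := by
  induction l with
  | nil => rfl
  | cons i l ih => rw [wordMap_cons, wordMap_cons, inner_sref_sref, ih]

theorem wordMap_sref (l : List (Fin S.n)) (α x : V) :
    S.wordMap l (sref α x) = sref (S.wordMap l α) (S.wordMap l x) := by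
  rw [sref, wordMap_sub, wordMap_smul, sref, inner_wordMap_wordMap, inner_wordMap_wordMap]

theorem simple_mem_R (i : Fin S.n) : S.simple i ∈ S.R := S.pos_sub (S.simple_mem i)

theorem wordMap_mem_R (l : List (Fin S.n)) {α : V} (hα : α ∈ S.R) : S.wordMap l α ∈ S.R := by
  induction l with
  | nil => exact hα
  | cons i l ih => exact S.refl_mem _ (S.simple_mem_R i) _ ih

end WordMap

section Roots

variable {S}

theorem inner_self_pos_of_mem_R {α : V} (hα : α ∈ S.R) : 0 < ⟪α, α⟫ :=
  real_inner_self_pos.mpr (S.root_ne_zero α hα)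

theorem Dominant.inner_nonneg {μ : V} (hμ : S.Dominant μ) {α : V} (hα : α ∈ S.Rpos) :
    0 ≤ ⟪μ, α⟫ := by
  obtain ⟨c, rfl⟩ := S.pos_combo α hα
  rw [inner_sum]
  refine Finset.sum_nonneg fun i _ => ?_
  rw [real_inner_smul_right]
  exact mul_nonneg (Nat.cast_nonneg _) (hμ i)

theorem coeff_unique {a b : Fin S.n → ℝ}
    (h : ∑ i, a i • S.simple i = ∑ i, b i • S.simple i) : a = b := by
  funext i
  have h0 : ∑ i, (a i - b i) • S.simple i = 0 := by
    simp only [sub_smul, Finset.sum_sub_distrib, h, sub_self]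
  exact sub_eq_zero.mp (Fintype.linearIndependent_iff.mp S.simple_indep _ h0 i)

theorem sref_simple_sum (i : Fin S.n) (c : Fin S.n → ℝ) :
    sref (S.simple i) (∑ j, c j • S.simple j) =
      ∑ j, (c j - if j = i then ⟪∑ j, c j • S.simple j, coroot (S.simple i)⟫ else 0) •
        S.simple j := by
  rw [sref_eq_sub_inner_coroot]
  simp [sub_smul, Finset.sum_sub_distrib, ite_smul]

/-- A simple reflection permutes the positive roots other than the simple root itself. -/
theorem sref_simple_mem_Rpos (i : Fin S.n) {β : V} (hβ : β ∈ S.Rpos) (hne : β ≠ S.simple i) :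
    sref (S.simple i) β ∈ S.Rpos := by
  refine (S.pos_or_neg _ (S.refl_mem _ (S.simple_mem_R i) _ (S.pos_sub hβ))).resolve_right ?_
  intro hneg
  obtain ⟨c, hc⟩ := S.pos_combo β hβ
  obtain ⟨d, hd⟩ := S.pos_combo _ hneg
  have hcd : ∀ j, j ≠ i → c j = 0 := by
    intro j hj
    have h := hc ▸ hd
    rw [sref_simple_sum, ← Finset.sum_neg_distrib] at h
    simp only [← neg_smul] at h
    have hj' := congrFun (coeff_unique h) j
    simp only [hj, if_false, sub_zero] at hj'
    have h1 : (0 : ℝ) ≤ c j := Nat.cast_nonneg _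
    have h2 : (0 : ℝ) ≤ d j := Nat.cast_nonneg _
    have h3 : (c j : ℝ) = 0 := by linarith
    exact_mod_cast h3
  have hβi : β = (c i : ℝ) • S.simple i := by
    rw [hc]
    refine Finset.sum_eq_single i (fun j _ hj => ?_) (by simp)
    simp [hcd j hj]
  rcases S.reduced _ (S.simple_mem_R i) (c i) (hβi ▸ S.pos_sub hβ) with h | h
  · exact hne (by rw [hβi, h, one_smul])
  · have : (0 : ℝ) ≤ c i := Nat.cast_nonneg _
    linarith

end Roots

section Exchange

variable {S}

/-- The strong exchange property for words in the simple reflections. -/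
theorem exists_shorter_word (l : List (Fin S.n)) {β : V} (hβ : β ∈ S.Rpos)
    (hneg : -S.wordMap l β ∈ S.Rpos) :
    ∃ l' : List (Fin S.n), l'.length < l.length ∧ ∀ x, S.wordMap l (sref β x) = S.wordMap l' x := by
  induction l with
  | nil => exact absurd hneg (S.not_both β hβ)
  | cons i l ih =>
    rcases S.pos_or_neg _ (S.wordMap_mem_R l (S.pos_sub hβ)) with h | h
    · have hi : S.wordMap l β = S.simple i := by
        by_contra hne
        exact S.not_both _ (sref_simple_mem_Rpos i h hne) hneg
      refine ⟨l, by simp, fun x => ?_⟩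
      rw [wordMap_cons, wordMap_sref, hi, sref_sref]
    · obtain ⟨l', hl', hx⟩ := ih h
      exact ⟨i :: l', by simpa using hl', fun x => by rw [wordMap_cons, hx, wordMap_cons]⟩

variable (S) in
/-- A word is reduced if no shorter word represents the same Weyl group element. -/
def IsReducedWord (l : List (Fin S.n)) : Prop :=
  ∀ l' : List (Fin S.n), S.wordMap l = S.wordMap l' → l.length ≤ l'.length

theorem IsReducedWord.tail {i : Fin S.n} {l : List (Fin S.n)} (h : S.IsReducedWord (i :: l)) :
    S.IsReducedWord l := by
  intro l' hl'
  have := h (i :: l') (by funext x; rw [wordMap_cons, wordMap_cons, hl'])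
  simpa using this

theorem IsReducedWord.wordMap_reverse_simple_mem {i : Fin S.n} {l : List (Fin S.n)}
    (h : S.IsReducedWord (i :: l)) : S.wordMap l.reverse (S.simple i) ∈ S.Rpos := by
  refine (S.pos_or_neg _ (S.wordMap_mem_R _ (S.simple_mem_R i))).resolve_right fun hneg => ?_
  have hw : -S.wordMap l (-S.wordMap l.reverse (S.simple i)) ∈ S.Rpos := by
    rw [wordMap_neg, wordMap_wordMap_reverse, neg_neg]
    exact S.simple_mem i
  obtain ⟨l', hl', hx⟩ := exists_shorter_word l hneg hw
  have := h l' <| by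
    funext x
    rw [← hx, wordMap_sref, wordMap_neg, wordMap_wordMap_reverse, sref_neg_left, wordMap_cons]
  simp only [List.length_cons] at this
  omega

theorem mem_piSet {w : V → V} {α : V} : α ∈ S.PiSet w ↔ α ∈ S.Rpos ∧ -w α ∈ S.Rpos :=
  Finset.mem_filter

theorem IsReducedWord.piSet_cons {i : Fin S.n} {l : List (Fin S.n)}
    (h : S.IsReducedWord (i :: l)) :
    S.PiSet (S.wordMap (i :: l)) =
      insert (S.wordMap l.reverse (S.simple i)) (S.PiSet (S.wordMap l)) := by
  have hpos := h.wordMap_reverse_simple_mem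
  ext α
  simp only [Finset.mem_insert, mem_piSet, wordMap_cons]
  have hself := sref_self (S.root_ne_zero _ (S.simple_mem_R i))
  constructor
  · rintro ⟨hα, hneg⟩
    rcases S.pos_or_neg _ (S.wordMap_mem_R l (S.pos_sub hα)) with h1 | h1
    · left
      have hi : S.wordMap l α = S.simple i := by
        by_contra hne
        exact S.not_both _ (sref_simple_mem_Rpos i h1 hne) hneg
      rw [← hi, wordMap_reverse_wordMap]
    · exact Or.inr ⟨hα, h1⟩
  · rintro (rfl | ⟨hα, hneg⟩)
    · refine ⟨hpos, ?_⟩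
      rw [wordMap_wordMap_reverse, hself, neg_neg]
      exact S.simple_mem i
    · refine ⟨hα, ?_⟩
      have hne : -S.wordMap l α ≠ S.simple i := by
        intro he
        refine S.not_both _ hα ?_
        rwa [← S.wordMap_reverse_wordMap l α, ← wordMap_neg, he]
      have := sref_simple_mem_Rpos i hneg hne
      rwa [← neg_one_smul ℝ (S.wordMap l α), sref_smul, neg_one_smul] at this

theorem wordMap_reverse_simple_notMem_piSet (i : Fin S.n) (l : List (Fin S.n)) :
    S.wordMap l.reverse (S.simple i) ∉ S.PiSet (S.wordMap l) := by
  simp only [mem_piSet, wordMap_wordMap_reverse, not_and]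
  exact fun _ => S.not_both _ (S.simple_mem i)

/-- The length of a reduced word is the number of inversions. -/
theorem IsReducedWord.card_piSet {l : List (Fin S.n)} (h : S.IsReducedWord l) :
    (S.PiSet (S.wordMap l)).card = l.length := by
  induction l with
  | nil =>
    rw [List.length_nil, Finset.card_eq_zero, PiSet, Finset.filter_eq_empty_iff]
    exact fun α hα => S.not_both α hα
  | cons i l ih =>
    rw [h.piSet_cons, Finset.card_insert_of_notMem (wordMap_reverse_simple_notMem_piSet i l),
      ih h.tail, List.length_cons]

end Exchange

section Height

variable {S}

theorem htZ_sum (c : Fin S.n → ℤ) : S.htZ (∑ i, (c i : ℝ) • S.simple i) = ∑ i, c i := by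
  have h : ∃ d : Fin S.n → ℤ,
      ∑ i, (c i : ℝ) • S.simple i = ∑ i, (d i : ℝ) • S.simple i := ⟨c, rfl⟩
  rw [htZ, dif_pos h]
  have := coeff_unique h.choose_spec
  refine Finset.sum_congr rfl fun i _ => ?_
  exact_mod_cast (congrFun this i).symm

theorem inQ.exists_inner_coroot {x : V} (hx : S.inQ x) {α : V} (hα : α ∈ S.R) :
    ∃ k : ℤ, ⟪x, coroot α⟫ = k := by
  obtain ⟨c, rfl⟩ := hx
  choose k hk using fun i => S.crystal α hα _ (S.simple_mem_R i)
  refine ⟨∑ i, c i * k i, ?_⟩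
  simp [sum_inner, real_inner_smul_left, hk]

theorem inQ.sref_simple {x : V} (hx : S.inQ x) (i : Fin S.n) :
    S.inQ (sref (S.simple i) x) ∧
      (S.htZ (sref (S.simple i) x) : ℝ) = S.htZ x - ⟪x, coroot (S.simple i)⟫ := by
  obtain ⟨k, hk⟩ := hx.exists_inner_coroot (S.simple_mem_R i)
  obtain ⟨c, rfl⟩ := hx
  have h : sref (S.simple i) (∑ j, (c j : ℝ) • S.simple j) =
      ∑ j, ((c j - if j = i then k else 0 : ℤ) : ℝ) • S.simple j := by
    rw [sref_simple_sum, hk]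
    push_cast
    rfl
  refine ⟨⟨_, h⟩, ?_⟩
  rw [h, htZ_sum, htZ_sum, hk]
  simp [Finset.sum_sub_distrib]

theorem inQ.wordMap {x : V} (hx : S.inQ x) (l : List (Fin S.n)) : S.inQ (S.wordMap l x) := by
  induction l with
  | nil => exact hx
  | cons i l ih => exact (ih.sref_simple i).1

/-- The drop in height caused by a Weyl group element is the sum of the pairings with the
coroots of its inversions. -/
theorem IsReducedWord.sum_piSet {l : List (Fin S.n)} (h : S.IsReducedWord l) {x : V}
    (hx : S.inQ x) :
    ∑ α ∈ S.PiSet (S.wordMap l), ⟪x, coroot α⟫ = S.htZ x - S.htZ (S.wordMap l x) := by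
  induction l with
  | nil =>
    have h0 : S.PiSet (S.wordMap []) = ∅ := by
      rw [← Finset.card_eq_zero, h.card_piSet, List.length_nil]
    rw [h0, Finset.sum_empty]
    exact (sub_self _).symm
  | cons i l ih =>
    rw [h.piSet_cons, Finset.sum_insert (wordMap_reverse_simple_notMem_piSet i l), ih h.tail,
      wordMap_cons, ((hx.wordMap l).sref_simple i).2, inner_coroot, inner_coroot,
      ← S.inner_wordMap_wordMap l x, ← S.inner_wordMap_wordMap l (S.wordMap l.reverse _),
      wordMap_wordMap_reverse]
    ring

end Height

section MinWord

variable {S}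

theorem exists_word_of_isWeyl {w : V → V} (hw : S.IsWeyl w) :
    ∃ l : List (Fin S.n), l.length = S.len w ∧ w = S.wordMap l := by
  obtain ⟨l, hl⟩ := hw
  exact Nat.sInf_mem (s := {k | ∃ l : List (Fin S.n), l.length = k ∧ w = S.wordMap l})
    ⟨l.length, l, rfl, hl⟩

theorem len_wordMap_le (l : List (Fin S.n)) : S.len (S.wordMap l) ≤ l.length :=
  Nat.sInf_le ⟨l, rfl, rfl⟩

theorem IsMinWord.exists_word {x y : V} {w : V → V} (hw : S.IsMinWord x y w) :
    ∃ l : List (Fin S.n), l.length = S.len w ∧ w = S.wordMap l ∧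
      ∀ l' : List (Fin S.n), S.wordMap l' x = y → l.length ≤ l'.length := by
  obtain ⟨hW, -, hmin⟩ := hw
  obtain ⟨l, hl, hwl⟩ := exists_word_of_isWeyl hW
  exact ⟨l, hl, hwl, fun l' hl' => hl ▸ (hmin _ ⟨l', rfl⟩ hl').trans (len_wordMap_le l')⟩

theorem Dominant.inner_pos_of_mem_piSet {μ : V} (hμ : S.Dominant μ) {l : List (Fin S.n)}
    (hmin : ∀ l' : List (Fin S.n), S.wordMap l' μ = S.wordMap l μ → l.length ≤ l'.length)
    {α : V} (hα : α ∈ S.PiSet (S.wordMap l)) : 0 < ⟪μ, α⟫ := by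
  obtain ⟨hpos, hneg⟩ := mem_piSet.mp hα
  refine lt_of_le_of_ne (hμ.inner_nonneg hpos) fun h0 => ?_
  obtain ⟨l', hl', hx⟩ := exists_shorter_word l hpos hneg
  have := hmin l' (by rw [← hx, sref_of_inner_eq_zero h0.symm])
  omega

end MinWord

section RootLengths

variable {S}

theorem IsShort.sref {α β : V} (hβ : S.IsShort β) (hα : α ∈ S.R) : S.IsShort (sref α β) :=
  ⟨S.refl_mem α hα β hβ.1, by rw [inner_sref_sref]; exact hβ.2⟩

theorem IsShort.wordMap {α : V} (hα : S.IsShort α) (l : List (Fin S.n)) :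
    S.IsShort (S.wordMap l α) :=
  ⟨S.wordMap_mem_R l hα.1, by rw [inner_wordMap_wordMap]; exact hα.2⟩

theorem IsShort.inner_self_eq {α β : V} (hα : S.IsShort α) (hβ : S.IsShort β) :
    ⟪α, α⟫ = ⟪β, β⟫ :=
  le_antisymm (hα.2 β hβ.1) (hβ.2 α hα.1)

/-- Every root pairs nontrivially with some root of each occurring length. -/
theorem exists_inner_ne_zero {α β : V} (hα : α ∈ S.R) (hβ : β ∈ S.R) :
    ∃ α' ∈ S.R, ⟪α', α'⟫ = ⟪α, α⟫ ∧ ⟪β, α'⟫ ≠ 0 := by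
  have key := S.irred {x | ∃ α' ∈ S.R, ⟪α', α'⟫ = ⟪α, α⟫ ∧ ⟪x, α'⟫ ≠ 0} <| by
    rintro x hx y - ⟨δ, hδ, hδα, hxδ⟩ hy
    simp only [Set.mem_ofPred_eq, not_exists, not_and, not_not] at hy
    have h1 := hy δ hδ hδα
    have h2 := hy (_root_.sref x δ) (S.refl_mem x hx δ hδ) (by rw [inner_sref_sref, hδα])
    rw [_root_.sref, inner_sub_right, h1, zero_sub, neg_eq_zero, real_inner_smul_right,
      mul_eq_zero] at h2
    rw [real_inner_comm]
    refine h2.resolve_left (div_ne_zero (mul_ne_zero two_ne_zero ?_)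
      (inner_self_pos_of_mem_R hx).ne')
    rwa [real_inner_comm]
  exact key.resolve_right (fun h => h α hα ⟨α, hα, rfl, (inner_self_pos_of_mem_R hα).ne'⟩) β hβ

/-- A root that is not short is at least `√2` times as long as a short root. -/
theorem two_mul_inner_self_le {α β : V} (hα : α ∈ S.R) (hns : ¬ S.IsShort α)
    (hβ : S.IsShort β) : 2 * ⟪β, β⟫ ≤ ⟪α, α⟫ := by
  obtain ⟨δ, hδ, hδα, hne⟩ := exists_inner_ne_zero hα hβ.1
  rw [← hδα]
  have hlt : ⟪β, β⟫ < ⟪δ, δ⟫ := by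
    rw [hδα]
    by_contra hle
    exact hns ⟨hα, fun ε hε => (not_lt.mp hle).trans (hβ.2 ε hε)⟩
  obtain ⟨k, hk⟩ := S.crystal β hβ.1 δ hδ
  obtain ⟨m, hm⟩ := S.crystal δ hδ β hβ.1
  have hb := inner_self_pos_of_mem_R hβ.1
  have hd := inner_self_pos_of_mem_R hδ
  rw [inner_coroot, div_eq_iff hb.ne', real_inner_comm] at hk
  rw [inner_coroot, div_eq_iff hd.ne'] at hm
  have hcs : ⟪β, δ⟫ * ⟪β, δ⟫ ≤ ⟪β, β⟫ * ⟪δ, δ⟫ := real_inner_mul_inner_self_le β δ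
  have hkm : (k : ℝ) * m ≤ 4 := by
    have : (k * m : ℝ) * (⟪β, β⟫ * ⟪δ, δ⟫) ≤ 4 * (⟪β, β⟫ * ⟪δ, δ⟫) := by
      calc (k * m : ℝ) * (⟪β, β⟫ * ⟪δ, δ⟫) = (k * ⟪β, β⟫) * (m * ⟪δ, δ⟫) := by ring
        _ = (2 * ⟪β, δ⟫) * (2 * ⟪β, δ⟫) := by rw [← hk, ← hm]
        _ ≤ _ := by linarith
    exact le_of_mul_le_mul_right this (mul_pos hb hd)
  have hkm' : k * m ≤ 4 := by exact_mod_cast hkm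
  have heq : (k : ℝ) * ⟪β, β⟫ = m * ⟪δ, δ⟫ := by rw [← hk, ← hm]
  have hm0 : m ≠ 0 := by
    rintro rfl
    simp at hm
    exact hne hm
  by_contra! hcon
  rcases lt_or_gt_of_ne hm0 with hneg | hpos
  · have hmr : (m : ℝ) < 0 := by exact_mod_cast hneg
    have h1 : k < m := by
      have : (k : ℝ) < m := by
        by_contra! h
        nlinarith
      exact_mod_cast this
    have h2 : 2 * m < k := by
      have : (2 * m : ℝ) < k := by
        by_contra! h
        nlinarith
      exact_mod_cast this
    nlinarith
  · have hmr : (0 : ℝ) < m := by exact_mod_cast hpos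
    have h1 : m < k := by
      have : (m : ℝ) < k := by
        by_contra! h
        nlinarith
      exact_mod_cast this
    have h2 : k < 2 * m := by
      have : (k : ℝ) < 2 * m := by
        by_contra! h
        nlinarith
      exact_mod_cast this
    nlinarith

end RootLengths

section OrthogonalSum

variable {S}

/-- A sum of two orthogonal short roots which is not a root pairs to less than two with the
coroot of a root that is not short. -/
theorem inner_coroot_lt_two_of_not_isShort {α₀ β₀ α : V} (hα₀ : S.IsShort α₀)
    (hβ₀ : S.IsShort β₀) (horth : ⟪α₀, β₀⟫ = 0) (hnotroot : α₀ + β₀ ∉ S.R) (hα : α ∈ S.R)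
    (hns : ¬ S.IsShort α) : ⟪α₀ + β₀, coroot α⟫ < 2 := by
  by_contra! h
  have hpos := inner_self_pos_of_mem_R hα
  have hle := two_mul_inner_self_le hα hns hα₀
  have heq := hα₀.inner_self_eq hβ₀
  rw [inner_coroot, le_div_iff₀ hpos] at h
  have hself : ⟪α₀ + β₀, α₀ + β₀⟫ = 2 * ⟪α₀, α₀⟫ := by
    rw [real_inner_add_add_self, horth, ← heq]
    ring
  have hz : ⟪α₀ + β₀ - α, α₀ + β₀ - α⟫ ≤ 0 := by
    rw [real_inner_sub_sub_self, hself]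
    linarith
  have := real_inner_self_nonpos.mp hz
  exact hnotroot (sub_eq_zero.mp this ▸ hα)

theorem inner_coroot_lt_three_of_isShort {α₀ β₀ α : V} (hα₀ : S.IsShort α₀)
    (hβ₀ : S.IsShort β₀) (horth : ⟪α₀, β₀⟫ = 0) (hnotroot : α₀ + β₀ ∉ S.R) (hα : S.IsShort α) :
    ⟪α₀ + β₀, coroot α⟫ < 3 := by
  by_contra! h
  rw [inner_coroot, le_div_iff₀ (inner_self_pos_of_mem_R hα.1)] at h
  have hz : ⟪α₀ + β₀ - α, α₀ + β₀ - α⟫ ≤ 0 := by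
    rw [real_inner_sub_sub_self, real_inner_add_add_self, horth, hα₀.inner_self_eq hα,
      hβ₀.inner_self_eq hα]
    linarith
  exact hnotroot (sub_eq_zero.mp (real_inner_self_nonpos.mp hz) ▸ hα.1)

theorem IsShort.eq_of_two_le_inner_coroot {α β : V} (hα : S.IsShort α) (hβ : S.IsShort β)
    (h : 2 ≤ ⟪β, coroot α⟫) : β = α := by
  rw [inner_coroot, le_div_iff₀ (inner_self_pos_of_mem_R hα.1)] at h
  have hz : ⟪β - α, β - α⟫ ≤ 0 := by
    rw [real_inner_sub_sub_self, hβ.inner_self_eq hα]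
    linarith
  exact sub_eq_zero.mp (real_inner_self_nonpos.mp hz)

/-- A short root differs from a sum of two orthogonal short roots by a short root exactly when
its coroot pairs to two with the sum. -/
theorem isShort_sub_iff_inner_eq {α₀ β₀ α : V} (hα₀ : S.IsShort α₀)
    (hβ₀ : S.IsShort β₀) (horth : ⟪α₀, β₀⟫ = 0) (hα : S.IsShort α) :
    S.IsShort (α₀ + β₀ - α) ↔ ⟪α₀ + β₀, coroot α⟫ = 2 := by
  have hpos := inner_self_pos_of_mem_R hα.1
  have heqα := hα₀.inner_self_eq hα
  have heqβ := hβ₀.inner_self_eq hα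
  have hself : ⟪α₀ + β₀, α₀ + β₀⟫ = 2 * ⟪α, α⟫ := by
    rw [real_inner_add_add_self, horth, heqα, heqβ]
    ring
  rw [inner_coroot, div_eq_iff hpos.ne']
  constructor
  · intro h
    have h1 := h.inner_self_eq hα
    rw [real_inner_sub_sub_self, hself] at h1
    linarith
  · intro h
    have h1 : ⟪α₀ + β₀ - α, α₀ + β₀ - α⟫ = ⟪α, α⟫ := by
      rw [real_inner_sub_sub_self, hself]
      linarith
    refine ⟨?_, fun β hβ => h1.trans_le (hα.2 β hβ)⟩
    obtain ⟨p, hp⟩ := S.crystal α hα.1 α₀ hα₀.1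
    obtain ⟨q, hq⟩ := S.crystal α hα.1 β₀ hβ₀.1
    have hpq : p + q = 2 := by
      have : (p + q : ℝ) = 2 := by
        rw [← hp, ← hq, ← inner_add_left, inner_coroot, h]
        exact mul_div_cancel_right₀ _ hpos.ne'
      exact_mod_cast this
    rcases lt_or_ge p 2 with hp2 | hp2
    · rcases lt_or_ge q 2 with hq2 | hq2
      · obtain rfl : p = 1 := by omega
        obtain rfl : q = 1 := by omega
        have h2 := S.refl_mem β₀ hβ₀.1 _ (S.refl_mem α hα.1 α₀ hα₀.1)
        have h3 : ⟪α, coroot β₀⟫ = 1 := by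
          rw [inner_coroot, real_inner_comm, heqβ, ← inner_coroot, hq, Int.cast_one]
        have h4 : ⟪α₀, coroot β₀⟫ = 0 := by
          rw [inner_coroot, horth, mul_zero, zero_div]
        rw [sref_eq_sub_inner_coroot β₀, sref_eq_sub_inner_coroot α, hp, inner_sub_left,
          real_inner_smul_left, h3, h4] at h2
        convert h2 using 1
        simp only [Int.cast_one, one_smul, mul_one, zero_sub, neg_smul]
        abel
      · have : β₀ = α := hα.eq_of_two_le_inner_coroot hβ₀ (by rw [hq]; exact_mod_cast hq2)
        rw [← this, add_sub_cancel_right]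
        exact hα₀.1
    · have : α₀ = α := hα.eq_of_two_le_inner_coroot hα₀ (by rw [hp]; exact_mod_cast hp2)
      rw [← this, add_sub_cancel_left]
      exact hβ₀.1

theorem card_filter_inner_coroot_eq_two {α₀ β₀ : V} (hα₀ : S.IsShort α₀) (hβ₀ : S.IsShort β₀)
    (horth : ⟪α₀, β₀⟫ = 0) (hdom : S.Dominant (α₀ + β₀)) (l : List (Fin S.n)) :
    ((S.PiS (S.wordMap l)).filter fun α => ⟪α₀ + β₀, coroot α⟫ = 2).card =
      negCount S (S.wordMap l (α₀ + β₀)) := by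
  refine Finset.card_bij'
    (fun α _ => (S.wordMap l α, S.wordMap l (α₀ + β₀ - α)))
    (fun p _ => S.wordMap l.reverse p.1) ?_ ?_ ?_ ?_
  · intro α hα
    obtain ⟨hα, h2⟩ := Finset.mem_filter.mp hα
    obtain ⟨hα, hs⟩ := Finset.mem_filter.mp hα
    obtain ⟨-, hneg⟩ := mem_piSet.mp hα
    have hs' := (isShort_sub_iff_inner_eq hα₀ hβ₀ horth hs).mpr h2
    refine Finset.mem_filter.mpr ⟨Finset.mem_product.mpr
      ⟨(hs.wordMap l).1, (hs'.wordMap l).1⟩, hs.wordMap l, hs'.wordMap l, ?_, hneg⟩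
    rw [← wordMap_add, add_sub_cancel]
  · rintro ⟨δ, ε⟩ hp
    obtain ⟨-, hδ, hε, hsum, hneg⟩ := Finset.mem_filter.mp hp
    dsimp only at hδ hε hsum hneg ⊢
    have hs := hδ.wordMap l.reverse
    have hs' := hε.wordMap l.reverse
    have hsum' : S.wordMap l.reverse ε = α₀ + β₀ - S.wordMap l.reverse δ := by
      rw [← S.wordMap_reverse_wordMap l (α₀ + β₀), ← hsum, wordMap_add, add_sub_cancel_left]
    rw [hsum'] at hs'
    have h2 := (isShort_sub_iff_inner_eq hα₀ hβ₀ horth hs).mp hs'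
    refine Finset.mem_filter.mpr ⟨Finset.mem_filter.mpr ⟨mem_piSet.mpr ⟨?_, ?_⟩, hs⟩, h2⟩
    · refine (S.pos_or_neg _ hs.1).resolve_right fun hn => ?_
      have h3 := hdom.inner_nonneg hn
      rw [inner_coroot, div_eq_iff (inner_self_pos_of_mem_R hs.1).ne'] at h2
      rw [inner_neg_right] at h3
      linarith [inner_self_pos_of_mem_R hs.1]
    · rwa [wordMap_wordMap_reverse]
  · intro α _
    exact S.wordMap_reverse_wordMap l α
  · rintro ⟨δ, ε⟩ hp
    obtain ⟨-, -, -, hsum, -⟩ := Finset.mem_filter.mp hp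
    dsimp only at hsum ⊢
    rw [wordMap_sub, wordMap_wordMap_reverse, ← hsum, add_sub_cancel_left]

end OrthogonalSum

end RSD

/-- Let `μ ∈ Q` be dominant, a sum of two orthogonal short roots, and not
itself a root. Then for every `γ` in the Weyl orbit of `μ` one has `D_γ = D_γ(s) = n(γ)`,
where `D_γ = ht(μ) − ht(γ) − ℓ(w_γ)` and `D_γ(s) = Σ_{α ∈ Π_s(w_γ)} ((μ, α^∨) − 1)`. -/
theorem D_eq_Ds_eq_negCount
    {V : Type*} [NormedAddCommGroup V] [InnerProductSpace ℝ V]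
    (S : RSD V) (μ : V) (hQ : S.inQ μ) (hdom : S.Dominant μ)
    (hsum : ∃ α β : V, S.IsShort α ∧ S.IsShort β ∧ ⟪α, β⟫ = 0 ∧ μ = α + β)
    (hnotroot : μ ∉ S.R)
    (γ : V) (horb : S.sameOrbit μ γ)
    (w : V → V) (hw : S.IsMinWord μ γ w) :
    ((S.htZ μ - S.htZ γ - (S.len w : ℤ) : ℤ) : ℝ)
        = ∑ α ∈ S.PiS w, (⟪μ, coroot α⟫ - 1) ∧
      ∑ α ∈ S.PiS w, (⟪μ, coroot α⟫ - 1) = (negCount S γ : ℝ) := by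
  obtain ⟨α₀, β₀, hα₀, hβ₀, horth, rfl⟩ := hsum
  obtain ⟨l, hlen, rfl, hmin⟩ := hw.exists_word
  obtain rfl : S.wordMap l (α₀ + β₀) = γ := hw.2.1
  have hred : S.IsReducedWord l := fun l' h => hmin l' (by rw [h])
  have hpos : ∀ α ∈ S.PiSet (S.wordMap l), 1 ≤ ⟪α₀ + β₀, coroot α⟫ := by
    intro α hα
    have hαR := S.pos_sub (RSD.mem_piSet.mp hα).1
    obtain ⟨k, hk⟩ := hQ.exists_inner_coroot hαR
    have h0 : 0 < ⟪α₀ + β₀, coroot α⟫ := by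
      rw [inner_coroot]
      exact div_pos (mul_pos two_pos (hdom.inner_pos_of_mem_piSet hmin hα))
        (RSD.inner_self_pos_of_mem_R hαR)
    rw [hk] at h0 ⊢
    exact_mod_cast Int.add_one_le_of_lt (Int.cast_pos.mp h0)
  constructor
  · rw [RSD.PiS, Finset.sum_filter_of_ne, Finset.sum_sub_distrib, hred.sum_piSet hQ,
      Finset.sum_const, hred.card_piSet, ← hlen]
    · push_cast
      simp
    · intro α hα hne
      by_contra hns
      have hαR := S.pos_sub (RSD.mem_piSet.mp hα).1
      have h1 := hpos α hα
      have h2 := RSD.inner_coroot_lt_two_of_not_isShort hα₀ hβ₀ horth hnotroot hαR hns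
      obtain ⟨k, hk⟩ := hQ.exists_inner_coroot hαR
      rw [hk] at h1 h2 hne
      norm_cast at h1 h2
      obtain rfl : k = 1 := by omega
      simp at hne
  · rw [← RSD.card_filter_inner_coroot_eq_two hα₀ hβ₀ horth hdom l, Finset.card_filter]
    push_cast
    refine Finset.sum_congr rfl fun α hα => ?_
    obtain ⟨hα, hs⟩ := Finset.mem_filter.mp hα
    have h1 := hpos α hα
    have h2 : ⟪α₀ + β₀, coroot α⟫ < 3 :=
      RSD.inner_coroot_lt_three_of_isShort hα₀ hβ₀ horth hnotroot hs
    obtain ⟨k, hk⟩ := hQ.exists_inner_coroot hs.1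
    rw [hk] at h1 h2 ⊢
    norm_cast at h1 h2
    obtain rfl | rfl : k = 1 ∨ k = 2 := by omega
    · norm_num
    · norm_num

end
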